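/- Let n ≥ 1, let 0 < β < n be constant, let 1 < q₁ < n/β and define q₂ by 1/q₂ = 1/q₁ − β/n. Let 0 < p₁ ≤ p₂ < ∞, λ ≥ 0, and α < λ + n(1 − 1/q₁). Then there exists a constant C > 0 such that for every locally integrable function f on ℝⁿ one has ‖H_β f‖_{MK̇^{α,λ}_{p₂,q₂}} ≤ C ‖f‖_{MK̇^{α,λ}_{p₁,q₁}}. (This is the constant-exponent, unweighted case of Theorem 3.1, i.e. the case γ(x) = 0 and β(x) ≡ β.) -/

import Mathlib

open MeasureTheory ENNReal

/-- The dyadic annulus `A_k = B_k \ B_{k-1} = {x : 2^(k-1) < ‖x‖ ≤ 2^k}` in `ℝⁿ`. -/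
def annulus (n : ℕ) (k : ℤ) : Set (EuclideanSpace ℝ (Fin n)) :=
  {x | (2 : ℝ) ^ (k - 1) < ‖x‖ ∧ ‖x‖ ≤ (2 : ℝ) ^ k}

/-- The homogeneous Herz–Morrey norm
`‖f‖_{MK̇^{α,λ}_{p,q}} = sup_{k₀∈ℤ} 2^{−k₀λ} (Σ_{k≤k₀} 2^{kαp} ‖f χ_k‖_{L^q}^p)^{1/p}`. -/
noncomputable def herzMorreyNorm (n : ℕ) (α lam p q : ℝ)
    (f : EuclideanSpace ℝ (Fin n) → ℝ) : ℝ≥0∞ :=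
  ⨆ k₀ : ℤ, (2 : ℝ≥0∞) ^ (-(k₀ : ℝ) * lam) *
    (∑' k : {k : ℤ // k ≤ k₀},
      (2 : ℝ≥0∞) ^ (((k : ℤ) : ℝ) * α * p) *
        eLpNorm ((annulus n k).indicator f) (ENNReal.ofReal q) volume ^ p) ^ (1 / p)

/-- The n-dimensional fractional Hardy operator
`H_β f(x) = |x|^{β−n} ∫_{|t|<|x|} f(t) dt`. -/
noncomputable def hardyOp (n : ℕ) (β : ℝ) (f : EuclideanSpace ℝ (Fin n) → ℝ)
    (x : EuclideanSpace ℝ (Fin n)) : ℝ :=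
  ‖x‖ ^ (β - n) * ∫ t in {t : EuclideanSpace ℝ (Fin n) | ‖t‖ < ‖x‖}, f t

/-- Powers of `2` in `ℝ≥0∞` with real exponents add up. -/
lemma two_rpow_add (x y : ℝ) :
    (2 : ℝ≥0∞) ^ (x + y) = (2 : ℝ≥0∞) ^ x * (2 : ℝ≥0∞) ^ y :=
  ENNReal.rpow_add x y two_ne_zero ofNat_ne_top

lemma two_rpow_ne_top (x : ℝ) : (2 : ℝ≥0∞) ^ x ≠ ∞ :=
  ENNReal.rpow_ne_top_of_ne_zero two_ne_zero ofNat_ne_top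

lemma tsum_two_rpow_neg_ne_top {ε : ℝ} (hε : 0 < ε) :
    ∑' i : ℕ, (2 : ℝ≥0∞) ^ (-(i : ℝ) * ε) ≠ ∞ := by
  have h : ∀ i : ℕ, (2 : ℝ≥0∞) ^ (-(i : ℝ) * ε) = ((2 : ℝ≥0∞) ^ (-ε)) ^ i := fun i ↦ by
    rw [← ENNReal.rpow_natCast, ← ENNReal.rpow_mul]
    congr 1
    ring
  have hlt : (2 : ℝ≥0∞) ^ (-ε) < 1 :=
    ENNReal.rpow_lt_one_of_one_lt_of_neg one_lt_two (neg_lt_zero.2 hε)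
  simp_rw [h]
  rw [ENNReal.tsum_geometric]
  exact ENNReal.inv_ne_top.2 (tsub_pos_of_lt hlt).ne'

lemma le_tsum_rpow_rpow_inv {ι : Type*} (a : ι → ℝ≥0∞) {p : ℝ} (hp : 0 < p) (i : ι) :
    a i ≤ (∑' j, a j ^ p) ^ (1 / p) := by
  rw [one_div, ENNReal.le_rpow_inv_iff hp]
  exact ENNReal.le_tsum i

/-- The inclusion `ℓ^p ⊆ ℓ^q` for `p ≤ q`. -/
lemma tsum_rpow_le_tsum_rpow_rpow {ι : Type*} (a : ι → ℝ≥0∞) {p q : ℝ} (hp : 0 < p)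
    (hpq : p ≤ q) : ∑' i, a i ^ q ≤ ((∑' i, a i ^ p) ^ (1 / p)) ^ q := by
  set T := ∑' i, a i ^ p with hT
  calc ∑' i, a i ^ q ≤ ∑' i, a i ^ p * (T ^ (1 / p)) ^ (q - p) := by
        refine ENNReal.tsum_le_tsum fun i ↦ ?_
        have h : q = p + (q - p) := by ring
        conv_lhs => rw [h, ENNReal.rpow_add_of_nonneg _ _ hp.le (sub_nonneg.2 hpq)]
        gcongr
        exact le_tsum_rpow_rpow_inv a hp i
    _ = T * (T ^ (1 / p)) ^ (q - p) := by rw [ENNReal.tsum_mul_right]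
    _ = (T ^ (1 / p)) ^ p * (T ^ (1 / p)) ^ (q - p) := by
        congr 1
        rw [← ENNReal.rpow_mul, one_div_mul_cancel hp.ne', ENNReal.rpow_one]
    _ = (T ^ (1 / p)) ^ q := by
        rw [← ENNReal.rpow_add_of_nonneg _ _ hp.le (sub_nonneg.2 hpq)]
        congr 1
        ring

lemma tsum_mul_rpow_le {ι : Type*} (w c : ι → ℝ≥0∞) {p : ℝ} (hp : 0 < p) :
    (∑' i, w i * c i) ^ p ≤ (∑' i, w i) ^ p * ∑' i, c i ^ p := by
  calc (∑' i, w i * c i) ^ p ≤ (∑' i, w i * (∑' j, c j ^ p) ^ (1 / p)) ^ p := by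
        gcongr with i
        exact le_tsum_rpow_rpow_inv c hp i
    _ = (∑' i, w i) ^ p * ∑' i, c i ^ p := by
        rw [ENNReal.tsum_mul_right, ENNReal.mul_rpow_of_nonneg _ _ hp.le, ← ENNReal.rpow_mul,
          one_div_mul_cancel hp.ne', ENNReal.rpow_one]

/-- The Morrey-type sequence norm `sup_{k₀} 2^{-k₀λ} (∑_{k ≤ k₀} a_k^p)^{1/p}`. -/
noncomputable def morreySeqNorm (lam p : ℝ) (a : ℤ → ℝ≥0∞) : ℝ≥0∞ :=
  ⨆ k₀ : ℤ, (2 : ℝ≥0∞) ^ (-(k₀ : ℝ) * lam) * (∑' k : {k : ℤ // k ≤ k₀}, a k ^ p) ^ (1 / p)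

lemma tsum_rpow_le_morreySeqNorm (lam : ℝ) {p q : ℝ} (hp : 0 < p) (hpq : p ≤ q)
    (a : ℤ → ℝ≥0∞) (m : ℤ) :
    ∑' k : {k : ℤ // k ≤ m}, a k ^ q ≤
      ((2 : ℝ≥0∞) ^ ((m : ℝ) * lam) * morreySeqNorm lam p a) ^ q := by
  refine (tsum_rpow_le_tsum_rpow_rpow _ hp hpq).trans ?_
  refine ENNReal.rpow_le_rpow ?_ (hp.le.trans hpq)
  have h := le_iSup (fun k₀ : ℤ ↦ (2 : ℝ≥0∞) ^ (-(k₀ : ℝ) * lam) *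
    (∑' k : {k : ℤ // k ≤ k₀}, a k ^ p) ^ (1 / p)) m
  calc _ = (2 : ℝ≥0∞) ^ ((m : ℝ) * lam) * ((2 : ℝ≥0∞) ^ (-(m : ℝ) * lam) *
        (∑' k : {k : ℤ // k ≤ m}, a k ^ p) ^ (1 / p)) := by
        rw [← mul_assoc, ← two_rpow_add]
        simp
    _ ≤ _ := by
        gcongr
        exact h

/-- A one-sided geometric convolution with ratio `2^{-δ}`, `δ + λ > 0`, is bounded between
Morrey-type sequence spaces. -/
lemma morreySeqNorm_convolution_le {lam p q δ : ℝ} (hp : 0 < p) (hpq : p ≤ q)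
    (hδ : 0 < δ + lam) {K : ℝ≥0∞} (hK : K ≠ ∞) :
    ∃ C : ℝ≥0∞, C ≠ ∞ ∧ ∀ a b : ℤ → ℝ≥0∞,
      (∀ k, b k ≤ K * ∑' i : ℕ, (2 : ℝ≥0∞) ^ (-(i : ℝ) * δ) * a (k - i)) →
      morreySeqNorm lam q b ≤ C * morreySeqNorm lam p a := by
  have hq : 0 < q := hp.trans_le hpq
  obtain ⟨ε, hε, hε'⟩ : ∃ ε, 0 < ε ∧ 0 < (δ + lam - ε) * q :=
    ⟨(δ + lam) / 2, by positivity, mul_pos (by linarith) hq⟩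
  set G := ∑' i : ℕ, (2 : ℝ≥0∞) ^ (-(i : ℝ) * ε) with hG
  set G' := ∑' i : ℕ, (2 : ℝ≥0∞) ^ (-(i : ℝ) * ((δ + lam - ε) * q)) with hG'
  have hGt : G ≠ ∞ := tsum_two_rpow_neg_ne_top hε
  have hGt' : G' ≠ ∞ := tsum_two_rpow_neg_ne_top hε'
  refine ⟨K * G * G' ^ (1 / q), by
    have := ENNReal.rpow_ne_top_of_nonneg (one_div_pos.2 hq).le hGt'
    finiteness, fun a b hab ↦ ?_⟩
  set M := morreySeqNorm lam p a with hM
  have hb : ∀ k, b k ^ q ≤ (K * G) ^ q *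
      ∑' i : ℕ, (2 : ℝ≥0∞) ^ (-(i : ℝ) * (δ - ε) * q) * a (k - i) ^ q := fun k ↦ by
    calc b k ^ q ≤ (K * ∑' i : ℕ, (2 : ℝ≥0∞) ^ (-(i : ℝ) * ε) *
          ((2 : ℝ≥0∞) ^ (-(i : ℝ) * (δ - ε)) * a (k - i))) ^ q := by
          refine ENNReal.rpow_le_rpow ((hab k).trans_eq ?_) hq.le
          congr 2 with i
          rw [← mul_assoc, ← two_rpow_add]
          congr 2
          ring
      _ ≤ K ^ q * (G ^ q * ∑' i : ℕ, ((2 : ℝ≥0∞) ^ (-(i : ℝ) * (δ - ε)) * a (k - i)) ^ q) := by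
          rw [ENNReal.mul_rpow_of_nonneg _ _ hq.le]
          gcongr
          exact tsum_mul_rpow_le _ _ hq
      _ = _ := by
          rw [← mul_assoc, ENNReal.mul_rpow_of_nonneg _ _ hq.le]
          congr 2 with i
          rw [ENNReal.mul_rpow_of_nonneg _ _ hq.le, ← ENNReal.rpow_mul]
  have hsum : ∀ k₀ : ℤ, ∑' k : {k : ℤ // k ≤ k₀}, b k ^ q ≤
      (K * G) ^ q * (G' * ((2 : ℝ≥0∞) ^ ((k₀ : ℝ) * lam) * M) ^ q) := fun k₀ ↦ by
    calc ∑' k : {k : ℤ // k ≤ k₀}, b k ^ q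
        ≤ ∑' k : {k : ℤ // k ≤ k₀}, (K * G) ^ q *
          ∑' i : ℕ, (2 : ℝ≥0∞) ^ (-(i : ℝ) * (δ - ε) * q) * a (k - i) ^ q :=
          ENNReal.tsum_le_tsum fun k ↦ hb k
      _ = (K * G) ^ q * ∑' i : ℕ, (2 : ℝ≥0∞) ^ (-(i : ℝ) * (δ - ε) * q) *
          ∑' k : {k : ℤ // k ≤ k₀}, a (k - i) ^ q := by
          rw [ENNReal.tsum_mul_left, ENNReal.tsum_comm]
          simp_rw [ENNReal.tsum_mul_left]
      _ ≤ (K * G) ^ q * ∑' i : ℕ, (2 : ℝ≥0∞) ^ (-(i : ℝ) * (δ - ε) * q) *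
          ((2 : ℝ≥0∞) ^ (((k₀ - i : ℤ) : ℝ) * lam) * M) ^ q := by
          gcongr with i
          refine le_trans ?_ (tsum_rpow_le_morreySeqNorm lam hp hpq a (k₀ - i))
          exact ENNReal.tsum_comp_le_tsum_of_injective
            (f := fun k : {k : ℤ // k ≤ k₀} ↦
              (⟨k - i, sub_le_sub_right k.2 _⟩ : {k : ℤ // k ≤ k₀ - i}))
            (fun x y hxy ↦ Subtype.ext (sub_left_injective (congrArg Subtype.val hxy)))
            (fun k ↦ a k ^ q)
      _ = (K * G) ^ q * (G' * ((2 : ℝ≥0∞) ^ ((k₀ : ℝ) * lam) * M) ^ q) := by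
          rw [hG', ← ENNReal.tsum_mul_right]
          congr 2 with i
          simp_rw [ENNReal.mul_rpow_of_nonneg _ _ hq.le, ← ENNReal.rpow_mul, ← mul_assoc,
            ← two_rpow_add]
          congr 2
          push_cast
          ring
  refine iSup_le fun k₀ ↦ ?_
  calc _ ≤ (2 : ℝ≥0∞) ^ (-(k₀ : ℝ) * lam) * ((K * G) ^ q *
        (G' * ((2 : ℝ≥0∞) ^ ((k₀ : ℝ) * lam) * M) ^ q)) ^ (1 / q) := by
        gcongr
        exact hsum k₀
    _ = (2 : ℝ≥0∞) ^ (-(k₀ : ℝ) * lam) * ((K * G) *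
        (G' ^ (1 / q) * ((2 : ℝ≥0∞) ^ ((k₀ : ℝ) * lam) * M))) := by
        have hq' : 0 ≤ 1 / q := by positivity
        rw [ENNReal.mul_rpow_of_nonneg _ _ hq', ENNReal.mul_rpow_of_nonneg _ _ hq',
          ← ENNReal.rpow_mul, ← ENNReal.rpow_mul, mul_one_div_cancel hq.ne', ENNReal.rpow_one,
          ENNReal.rpow_one]
    _ = ((2 : ℝ≥0∞) ^ (-(k₀ : ℝ) * lam) * (2 : ℝ≥0∞) ^ ((k₀ : ℝ) * lam)) *
        (K * G * G' ^ (1 / q) * M) := by ring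
    _ = _ := by
        rw [← two_rpow_add]
        simp

lemma herzMorreyNorm_eq_morreySeqNorm (n : ℕ) (α lam : ℝ) {p : ℝ} (hp : 0 < p) (q : ℝ)
    (f : EuclideanSpace ℝ (Fin n) → ℝ) :
    herzMorreyNorm n α lam p q f = morreySeqNorm lam p fun k ↦ (2 : ℝ≥0∞) ^ ((k : ℝ) * α) *
      eLpNorm ((annulus n k).indicator f) (ENNReal.ofReal q) volume := by
  simp_rw [herzMorreyNorm, morreySeqNorm, ENNReal.mul_rpow_of_nonneg _ _ hp.le, ENNReal.rpow_mul]

lemma measurableSet_annulus (n : ℕ) (k : ℤ) : MeasurableSet (annulus n k) :=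
  (measurableSet_lt measurable_const measurable_norm).inter
    (measurableSet_le measurable_norm measurable_const)

lemma volume_annulus_le (n : ℕ) (k : ℤ) :
    volume (annulus n k) ≤ (2 : ℝ≥0∞) ^ ((k : ℝ) * n) *
      volume (Metric.ball (0 : EuclideanSpace ℝ (Fin n)) 1) := by
  have hsub : annulus n k ⊆ Metric.closedBall 0 ((2 : ℝ) ^ k) := fun x hx ↦ by
    simpa using hx.2
  refine (measure_mono hsub).trans_eq ?_
  rw [Measure.addHaar_closedBall _ _ (by positivity), finrank_euclideanSpace_fin,
    ← Real.rpow_intCast, ← Real.rpow_natCast, ← Real.rpow_mul zero_le_two,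
    ← ENNReal.ofReal_rpow_of_pos two_pos, ENNReal.ofReal_ofNat]

/-- Hölder's inequality on an annulus. -/
lemma lintegral_enorm_annulus_le {n : ℕ} {q : ℝ} (hq : 1 ≤ q)
    {f : EuclideanSpace ℝ (Fin n) → ℝ} (hf : AEStronglyMeasurable f volume) (k : ℤ) :
    ∫⁻ t in annulus n k, ‖f t‖ₑ ≤
      volume (Metric.ball (0 : EuclideanSpace ℝ (Fin n)) 1) ^ (1 - 1 / q) *
        ((2 : ℝ≥0∞) ^ ((k : ℝ) * (n * (1 - 1 / q))) *
          eLpNorm ((annulus n k).indicator f) (ENNReal.ofReal q) volume) := by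
  have hq0 : 0 < q := one_pos.trans_le hq
  have he : 0 ≤ 1 - 1 / q := sub_nonneg.2 ((div_le_one hq0).2 hq)
  have h := eLpNorm_le_eLpNorm_mul_rpow_measure_univ (p := 1) (q := ENNReal.ofReal q)
    (by simpa using hq) (hf.restrict (s := annulus n k))
  rw [eLpNorm_one_eq_lintegral_enorm, ENNReal.toReal_ofReal hq0.le, ENNReal.toReal_one,
    Measure.restrict_apply_univ, div_one] at h
  rw [eLpNorm_indicator_eq_eLpNorm_restrict (measurableSet_annulus n k)]
  refine h.trans ?_
  calc _ ≤ eLpNorm f (ENNReal.ofReal q) (volume.restrict (annulus n k)) *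
        ((2 : ℝ≥0∞) ^ ((k : ℝ) * n) *
          volume (Metric.ball (0 : EuclideanSpace ℝ (Fin n)) 1)) ^ (1 - 1 / q) := by
        gcongr
        exact volume_annulus_le n k
    _ = _ := by
        rw [ENNReal.mul_rpow_of_nonneg _ _ he, ← ENNReal.rpow_mul, mul_assoc (k : ℝ)]
        ring

lemma setOf_norm_lt_subset_iUnion_annulus {n : ℕ} {k : ℤ} {x : EuclideanSpace ℝ (Fin n)}
    (hx : x ∈ annulus n k) :
    {t : EuclideanSpace ℝ (Fin n) | ‖t‖ < ‖x‖} ⊆ {0} ∪ ⋃ i : ℕ, annulus n (k - i) := by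
  intro t ht
  rcases eq_or_ne t 0 with rfl | h0
  · simp
  right
  obtain ⟨m, hm, hm'⟩ := _root_.exists_mem_Ioc_zpow (norm_pos_iff.2 h0) (one_lt_two (α := ℝ))
  have hlt : m < k :=
    (zpow_lt_zpow_iff_right₀ _root_.one_lt_two).1 (hm.trans (ht.out.trans_le hx.2))
  refine Set.mem_iUnion.2 ⟨(k - (m + 1)).toNat, ?_⟩
  have : k - ((k - (m + 1)).toNat : ℤ) = m + 1 := by lia
  rw [this]
  exact ⟨by simpa using hm, hm'⟩

lemma enorm_hardyOp_le {n : ℕ} (hn : 1 ≤ n) {β q : ℝ} (hβ : β ≤ n) (hq : 1 ≤ q)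
    {f : EuclideanSpace ℝ (Fin n) → ℝ} (hf : AEStronglyMeasurable f volume) {k : ℤ}
    {x : EuclideanSpace ℝ (Fin n)} (hx : x ∈ annulus n k) :
    ‖hardyOp n β f x‖ₑ ≤ (2 : ℝ≥0∞) ^ (((k : ℝ) - 1) * (β - n)) *
      (volume (Metric.ball (0 : EuclideanSpace ℝ (Fin n)) 1) ^ (1 - 1 / q) *
        ∑' i : ℕ, (2 : ℝ≥0∞) ^ (((k - i : ℤ) : ℝ) * (n * (1 - 1 / q))) *
          eLpNorm ((annulus n (k - i)).indicator f) (ENNReal.ofReal q) volume) := by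
  have : Nonempty (Fin n) := ⟨⟨0, hn⟩⟩
  have hx0 : 0 < ‖x‖ := lt_trans (by positivity) hx.1
  rw [hardyOp, enorm_mul]
  gcongr
  · rw [Real.enorm_of_nonneg (by positivity)]
    calc ENNReal.ofReal (‖x‖ ^ (β - n)) ≤ ENNReal.ofReal (((2 : ℝ) ^ (k - 1)) ^ (β - n)) :=
          ENNReal.ofReal_le_ofReal
            (Real.rpow_le_rpow_of_nonpos (by positivity) hx.1.le (sub_nonpos.2 hβ))
      _ = _ := by
          rw [← Real.rpow_intCast, ← Real.rpow_mul zero_le_two,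
            ← ENNReal.ofReal_rpow_of_pos two_pos, ENNReal.ofReal_ofNat]
          push_cast
          rfl
  · calc ‖∫ t in {t : EuclideanSpace ℝ (Fin n) | ‖t‖ < ‖x‖}, f t‖ₑ
        ≤ ∫⁻ t in {t : EuclideanSpace ℝ (Fin n) | ‖t‖ < ‖x‖}, ‖f t‖ₑ :=
          enorm_integral_le_lintegral_enorm _
      _ ≤ ∫⁻ t in {0} ∪ ⋃ i : ℕ, annulus n (k - i), ‖f t‖ₑ :=
          lintegral_mono_set (setOf_norm_lt_subset_iUnion_annulus hx)
      _ ≤ ∑' i : ℕ, ∫⁻ t in annulus n (k - i), ‖f t‖ₑ := by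
          refine (lintegral_union_le _ _ _).trans ?_
          rw [setLIntegral_measure_zero _ _ (measure_singleton 0), zero_add]
          exact lintegral_iUnion_le _ _
      _ ≤ _ := by
          rw [← ENNReal.tsum_mul_left]
          exact ENNReal.tsum_le_tsum fun i ↦ lintegral_enorm_annulus_le hq hf _

/-- On each annulus, `H_β f` is controlled by a geometric convolution of the local norms of `f`. -/
lemma eLpNorm_indicator_hardyOp_le {n : ℕ} (hn : 1 ≤ n) {β q₁ q₂ : ℝ} (hβ : β ≤ n)
    (hq₁ : 1 ≤ q₁) (hq₂0 : 0 < q₂) (hq₂ : 1 / q₂ = 1 / q₁ - β / n)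
    {f : EuclideanSpace ℝ (Fin n) → ℝ} (hf : AEStronglyMeasurable f volume) (k : ℤ) :
    eLpNorm ((annulus n k).indicator (hardyOp n β f)) (ENNReal.ofReal q₂) volume ≤
      ((2 : ℝ≥0∞) ^ (n - β) *
        (volume (Metric.ball (0 : EuclideanSpace ℝ (Fin n)) 1) ^ (1 - 1 / q₁) *
          volume (Metric.ball (0 : EuclideanSpace ℝ (Fin n)) 1) ^ (1 / q₂))) *
        ∑' i : ℕ, (2 : ℝ≥0∞) ^ (-(i : ℝ) * (n * (1 - 1 / q₁))) *
          eLpNorm ((annulus n (k - i)).indicator f) (ENNReal.ofReal q₁) volume := by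
  have hn0 : (n : ℝ) ≠ 0 := by positivity
  rw [eLpNorm_indicator_eq_eLpNorm_restrict (measurableSet_annulus n k)]
  refine (eLpNorm_le_of_ae_enorm_bound (ae_restrict_of_forall_mem (measurableSet_annulus n k)
    fun x hx ↦ enorm_hardyOp_le hn hβ hq₁ hf hx)).trans ?_
  rw [Measure.restrict_apply_univ, ENNReal.toReal_ofReal hq₂0.le, smul_eq_mul, ← one_div]
  have hvol : volume (annulus n k) ^ (1 / q₂) ≤
      (2 : ℝ≥0∞) ^ ((k : ℝ) * n * (1 / q₂)) *
        volume (Metric.ball (0 : EuclideanSpace ℝ (Fin n)) 1) ^ (1 / q₂) := by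
    rw [ENNReal.rpow_mul, ← ENNReal.mul_rpow_of_nonneg _ _ (by positivity)]
    gcongr
    exact volume_annulus_le n k
  refine (mul_le_mul_right hvol _).trans_eq ?_
  have hterm : ∀ i : ℕ, (2 : ℝ≥0∞) ^ (((k - i : ℤ) : ℝ) * (n * (1 - 1 / q₁))) =
      (2 : ℝ≥0∞) ^ ((k : ℝ) * (n * (1 - 1 / q₁))) *
        (2 : ℝ≥0∞) ^ (-(i : ℝ) * (n * (1 - 1 / q₁))) := fun i ↦ by
    rw [← two_rpow_add]
    push_cast
    congr 1
    ring
  have hexp : (n : ℝ) - β = ((k : ℝ) - 1) * (β - n) + (k : ℝ) * (n * (1 - 1 / q₁)) +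
      (k : ℝ) * n * (1 / q₂) := by
    rw [hq₂]
    field_simp
    ring
  simp_rw [hterm, mul_assoc, ENNReal.tsum_mul_left]
  rw [hexp, two_rpow_add, two_rpow_add]
  ring_nf

/-- The constant-exponent, unweighted case of Theorem 3.1: boundedness of the
fractional Hardy operator `H_β` from `MK̇^{α,λ}_{p₁,q₁}` to `MK̇^{α,λ}_{p₂,q₂}`. -/
theorem fractionalHardy_herzMorrey_bound
    (n : ℕ) (hn : 1 ≤ n) (β q₁ q₂ p₁ p₂ lam α : ℝ)
    (hβ0 : 0 < β) (hβn : β < n)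
    (hq₁ : 1 < q₁) (hq₁' : q₁ < n / β)
    (hq₂ : 1 / q₂ = 1 / q₁ - β / n)
    (hp₁ : 0 < p₁) (hp₁₂ : p₁ ≤ p₂)
    (hlam : 0 ≤ lam)
    (hα : α < lam + n * (1 - 1 / q₁)) :
    ∃ C : ℝ, 0 < C ∧
      ∀ f : EuclideanSpace ℝ (Fin n) → ℝ, LocallyIntegrable f volume →
        herzMorreyNorm n α lam p₂ q₂ (hardyOp n β f) ≤
          ENNReal.ofReal C * herzMorreyNorm n α lam p₁ q₁ f := by
  have hn0 : (0 : ℝ) < n := by exact_mod_cast hn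
  have hq₂0 : 0 < q₂ := by
    have h : β / n < 1 / q₁ := by
      rw [div_lt_div_iff₀ hn0 (by positivity), one_mul, mul_comm]
      exact (lt_div_iff₀ hβ0).1 hq₁'
    exact one_div_pos.1 (hq₂ ▸ sub_pos.2 h)
  set V := volume (Metric.ball (0 : EuclideanSpace ℝ (Fin n)) 1)
  set K : ℝ≥0∞ := (2 : ℝ≥0∞) ^ (n - β) * (V ^ (1 - 1 / q₁) * V ^ (1 / q₂))
  have hV : V ≠ ∞ := measure_ball_lt_top.ne
  have hK : K ≠ ∞ := ENNReal.mul_ne_top (two_rpow_ne_top _) (ENNReal.mul_ne_top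
    (ENNReal.rpow_ne_top_of_nonneg (sub_nonneg.2 ((div_le_one (by positivity)).2 hq₁.le)) hV)
    (ENNReal.rpow_ne_top_of_nonneg (by positivity) hV))
  obtain ⟨C, hC, h⟩ := morreySeqNorm_convolution_le (lam := lam)
    (δ := n * (1 - 1 / q₁) - α) hp₁ hp₁₂ (by linarith) hK
  refine ⟨C.toReal + 1, by positivity, fun f hf ↦ ?_⟩
  rw [herzMorreyNorm_eq_morreySeqNorm n α lam (hp₁.trans_le hp₁₂),
    herzMorreyNorm_eq_morreySeqNorm n α lam hp₁]
  have hC' : C ≤ ENNReal.ofReal (C.toReal + 1) :=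
    (ENNReal.le_ofReal_iff_toReal_le hC (by positivity)).2 (by linarith)
  refine (h _ _ fun k ↦ ?_).trans (mul_le_mul_left hC' _)
  refine (mul_le_mul_right (eLpNorm_indicator_hardyOp_le hn hβn.le hq₁.le hq₂0 hq₂
    hf.aestronglyMeasurable k) _).trans_eq ?_
  rw [mul_left_comm, ← ENNReal.tsum_mul_left]
  congr 2 with i
  rw [← mul_assoc, ← two_rpow_add, ← mul_assoc ((2 : ℝ≥0∞) ^ _), ← two_rpow_add]
  push_cast
  congr 2
  ring
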